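/- Let Θ be a countable model with prior π such that density ratios are uniformly bounded by some v > 1 and such that Σ_{θ∈Θ} π(θ)^η < ∞ for some η ∈ (0,1). Then for every a > 0 there exist constants C₀, C₁ > 0 such that for all n ≥ 2, the Bayesian joint probability Π( (θ*, Z^n) : δ̄_n(θ*, Z^n) ≥ C₀ · (log n)/n ) ≤ C₁ · n^{−a}. (Theorem 1, first part: a Bayesian a priori believes the expected mixability gap is small.) -/

import Mathlib

open MeasureTheory ENNReal

noncomputable section

/-- Unnormalized posterior weight of `θ` given the sample `z`. -/
def postNum {Z : Type*} {Θ : Type*} (π : Θ → ℝ) (f : Θ → Z → ℝ) {n : ℕ}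
    (z : Fin n → Z) (θ : Θ) : ℝ :=
  π θ * ∏ i, f θ (z i)

/-- The Bayesian posterior of `θ` given the sample `z`. -/
def post {Z : Type*} {Θ : Type*} (π : Θ → ℝ) (f : Θ → Z → ℝ) {n : ℕ}
    (z : Fin n → Z) (θ : Θ) : ℝ :=
  postNum π f z θ / ∑' θ', postNum π f z θ'

/-- The Bayes predictive density of a next outcome `x` given the sample `z`. -/
def pBayes {Z : Type*} {Θ : Type*} (π : Θ → ℝ) (f : Θ → Z → ℝ) {n : ℕ}
    (z : Fin n → Z) (x : Z) : ℝ :=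
  ∑' θ, post π f z θ * f θ x

/-- The expected next-step mixability gap `δ̄_n(θ*, z^n)`. -/
def deltaBar {Z : Type*} [MeasurableSpace Z] (ρ : Measure Z) {Θ : Type*}
    (π : Θ → ℝ) (f : Θ → Z → ℝ) {n : ℕ} (θstar : Θ) (z : Fin n → Z) : ℝ :=
  ∫ x, ((∑' θ, post π f z θ * (-Real.log (f θ x))) + Real.log (pBayes π f z x)) *
    f θstar x ∂ρ

/-- The Bayesian joint probability `Π` of an event `E` (which may depend on the
sampled parameter `θ*`): `Σ_{θ*} π(θ*) · P_{θ*}^{⊗n}(E θ*)`, where `P_{θ*}^{⊗n}` is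
the product measure on `Z^n` with density `∏_i f_{θ*}(z_i)` w.r.t. `ρ^{⊗n}`. -/
def jointProb {Z : Type*} [MeasurableSpace Z] (ρ : Measure Z) [SigmaFinite ρ]
    {Θ : Type*} (π : Θ → ℝ) (f : Θ → Z → ℝ) (n : ℕ)
    (E : Θ → Set (Fin n → Z)) : ℝ≥0∞ :=
  ∑' θstar, ENNReal.ofReal (π θstar) *
    ((Measure.pi fun _ : Fin n => ρ).withDensity
      fun z => ENNReal.ofReal (∏ i, f θstar (z i))) (E θstar)

/-- On pairs with bounded ratio, the integrand of the relative entropy is dominated by the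
integrand of the squared Hellinger distance. -/
lemma klIntegrand_le_hellinger {v x y : ℝ} (hv : 1 < v) (hx : 0 < x) (hy : 0 < y)
    (hyx : y ≤ v * x) :
    y * (Real.log y - Real.log x) + (x - y) ≤ (1 + 2 * v) * (√x - √y) ^ 2 := by
  set s := √x with hs
  set t := √y with ht
  have hs0 : 0 < s := Real.sqrt_pos.2 hx
  have ht0 : 0 < t := Real.sqrt_pos.2 hy
  have hxs : x = s ^ 2 := (Real.sq_sqrt hx.le).symm
  have hyt : y = t ^ 2 := (Real.sq_sqrt hy.le).symm
  have hts : t ≤ v * s := by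
    refine abs_le_of_sq_le_sq' ?_ (by positivity) |>.2
    rw [hxs, hyt] at hyx
    nlinarith [mul_pos hs0 hs0, mul_pos (sub_pos.2 hv) (mul_pos hs0 hs0)]
  have hq : t / s ≤ v := by rwa [div_le_iff₀ hs0]
  have hlog : Real.log y - Real.log x ≤ 2 * (t / s - 1) := by
    rw [hxs, hyt, Real.log_pow, Real.log_pow]
    have := Real.log_le_sub_one_of_pos (div_pos ht0 hs0)
    rw [Real.log_div ht0.ne' hs0.ne'] at this
    push_cast
    linarith
  calc y * (Real.log y - Real.log x) + (x - y)
      ≤ y * (2 * (t / s - 1)) + (x - y) := by gcongr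
    _ = (1 + 2 * (t / s)) * (s - t) ^ 2 := by
        rw [hxs, hyt]; field_simp; ring
    _ ≤ (1 + 2 * v) * (s - t) ^ 2 := by gcongr

lemma sq_sub_sqrt_le_add {x y : ℝ} (hx : 0 ≤ x) (hy : 0 ≤ y) : (√x - √y) ^ 2 ≤ x + y := by
  nlinarith [Real.sq_sqrt hx, Real.sq_sqrt hy,
    mul_nonneg (Real.sqrt_nonneg x) (Real.sqrt_nonneg y)]

lemma mixabilityGap_mul_le {Θ : Type*} {p g : Θ → ℝ} {v y : ℝ} (hv : 1 < v)
    (hp : ∀ θ, 0 ≤ p θ) (hp1 : HasSum p 1) (hg : ∀ θ, 0 < g θ) (hy : 0 < y)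
    (hgy : ∀ θ, g θ ≤ v * y) (hyg : ∀ θ, y ≤ v * g θ) :
    ((∑' θ, p θ * (-Real.log (g θ))) + Real.log (∑' θ, p θ * g θ)) * y ≤
      ∑' θ, p θ * ((1 + 2 * v) * (√(g θ) - √y) ^ 2) := by
  have hv0 : 0 < v := by linarith
  have key {u : Θ → ℝ} (C : ℝ) (hu : ∀ θ, |u θ| ≤ C) : Summable fun θ => p θ * u θ := by
    refine Summable.of_norm_bounded (hp1.summable.mul_right C) fun θ => ?_
    rw [Real.norm_eq_abs, abs_mul, abs_of_nonneg (hp θ)]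
    exact mul_le_mul_of_nonneg_left (hu θ) (hp θ)
  have hsg : Summable fun θ => p θ * g θ :=
    key (v * y) fun θ => by rw [abs_of_pos (hg θ)]; exact hgy θ
  have hslog : Summable fun θ => p θ * (-Real.log (g θ)) := by
    refine key (|Real.log y| + Real.log v) fun θ => ?_
    have h1 := Real.log_le_log (hg θ) (hgy θ)
    have h2 := Real.log_le_log hy (hyg θ)
    rw [Real.log_mul hv0.ne' hy.ne'] at h1
    rw [Real.log_mul hv0.ne' (hg θ).ne'] at h2
    rw [abs_neg, abs_le]
    constructor <;> linarith [neg_abs_le (Real.log y), le_abs_self (Real.log y)]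
  have hsH : Summable fun θ => p θ * ((1 + 2 * v) * (√(g θ) - √y) ^ 2) := by
    refine key ((1 + 2 * v) * (v * y + y)) fun θ => ?_
    rw [abs_of_nonneg (by positivity)]
    gcongr
    exact (sq_sub_sqrt_le_add (hg θ).le hy.le).trans (by linarith [hgy θ])
  have hm : 0 < ∑' θ, p θ * g θ := by
    have h1 : ∑' θ, p θ * (y / v) ≤ ∑' θ, p θ * g θ := by
      refine (hp1.summable.mul_right _).tsum_le_tsum (fun θ => ?_) hsg
      refine mul_le_mul_of_nonneg_left ?_ (hp θ)
      rw [div_le_iff₀ hv0]; linarith [hyg θ]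
    rw [tsum_mul_right, hp1.tsum_eq] at h1
    exact lt_of_lt_of_le (by positivity) h1
  have hlogm : Real.log (∑' θ, p θ * g θ) * y ≤ Real.log y * y + (∑' θ, p θ * g θ) - y := by
    have := Real.log_le_sub_one_of_pos (div_pos hm hy)
    rw [Real.log_div hm.ne' hy.ne'] at this
    have h2 := mul_le_mul_of_nonneg_right this hy.le
    rw [sub_mul, sub_mul, div_mul_cancel₀ _ hy.ne'] at h2
    linarith
  have hS : HasSum (fun θ => p θ * (-Real.log (g θ)) * y + p θ * (Real.log y * y - y) + p θ * g θ)
      ((∑' θ, p θ * (-Real.log (g θ))) * y + 1 * (Real.log y * y - y) + ∑' θ, p θ * g θ) :=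
    ((hslog.hasSum.mul_right y).add (hp1.mul_right _)).add hsg.hasSum
  calc _ ≤ (∑' θ, p θ * (-Real.log (g θ))) * y + 1 * (Real.log y * y - y) + ∑' θ, p θ * g θ := by
        rw [add_mul]; linarith
    _ = _ := hS.tsum_eq.symm
    _ ≤ _ := by
        refine hS.summable.tsum_le_tsum (fun θ => ?_) hsH
        have := mul_le_mul_of_nonneg_left
          (klIntegrand_le_hellinger hv (hg θ) hy (hyg θ)) (hp θ)
        linarith

/-- The squared Hellinger distance between two densities. -/
def sqHellinger {Z : Type*} [MeasurableSpace Z] (ρ : Measure Z) (g k : Z → ℝ) : ℝ :=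
  ∫ x, (√(g x) - √(k x)) ^ 2 ∂ρ

lemma integrable_sq_sqrt_sub {Z : Type*} [MeasurableSpace Z] {ρ : Measure Z} {g k : Z → ℝ}
    (hg : Integrable g ρ) (hk : Integrable k ρ) (hg0 : ∀ x, 0 ≤ g x) (hk0 : ∀ x, 0 ≤ k x) :
    Integrable (fun x => (√(g x) - √(k x)) ^ 2) ρ := by
  refine (hg.add hk).mono' ?_ (.of_forall fun x => ?_)
  · exact (((Real.continuous_sqrt.comp_aestronglyMeasurable hg.1).sub
      (Real.continuous_sqrt.comp_aestronglyMeasurable hk.1)).pow 2)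
  · rw [Real.norm_of_nonneg (sq_nonneg _)]
    exact sq_sub_sqrt_le_add (hg0 x) (hk0 x)

lemma sqHellinger_nonneg {Z : Type*} [MeasurableSpace Z] (ρ : Measure Z) (g k : Z → ℝ) :
    0 ≤ sqHellinger ρ g k :=
  integral_nonneg fun _ => sq_nonneg _

lemma sqHellinger_le_two {Z : Type*} [MeasurableSpace Z] {ρ : Measure Z} {g k : Z → ℝ}
    (hg : Integrable g ρ) (hk : Integrable k ρ) (hg0 : ∀ x, 0 ≤ g x) (hk0 : ∀ x, 0 ≤ k x)
    (hg1 : ∫ x, g x ∂ρ = 1) (hk1 : ∫ x, k x ∂ρ = 1) : sqHellinger ρ g k ≤ 2 := by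
  calc sqHellinger ρ g k ≤ ∫ x, (g x + k x) ∂ρ :=
        integral_mono (integrable_sq_sqrt_sub hg hk hg0 hk0) (hg.add hk)
          fun x => sq_sub_sqrt_le_add (hg0 x) (hk0 x)
    _ = 2 := by rw [integral_add hg hk, hg1, hk1]; norm_num

lemma integrable_sqrt_mul_sqrt {Z : Type*} [MeasurableSpace Z] {ρ : Measure Z} {g k : Z → ℝ}
    (hg : Integrable g ρ) (hk : Integrable k ρ) (hg0 : ∀ x, 0 ≤ g x) (hk0 : ∀ x, 0 ≤ k x) :
    Integrable (fun x => √(g x) * √(k x)) ρ := by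
  refine (hg.add hk).mono' ?_ (.of_forall fun x => ?_)
  · exact (Real.continuous_sqrt.comp_aestronglyMeasurable hg.1).mul
      (Real.continuous_sqrt.comp_aestronglyMeasurable hk.1)
  · rw [Real.norm_of_nonneg (by positivity), Pi.add_apply]
    nlinarith [Real.sq_sqrt (hg0 x), Real.sq_sqrt (hk0 x), sq_nonneg (√(g x) - √(k x)),
      hg0 x, hk0 x]

lemma integral_sqrt_mul_sqrt {Z : Type*} [MeasurableSpace Z] {ρ : Measure Z} {g k : Z → ℝ}
    (hg : Integrable g ρ) (hk : Integrable k ρ) (hg0 : ∀ x, 0 ≤ g x) (hk0 : ∀ x, 0 ≤ k x)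
    (hg1 : ∫ x, g x ∂ρ = 1) (hk1 : ∫ x, k x ∂ρ = 1) :
    ∫ x, √(g x) * √(k x) ∂ρ = 1 - sqHellinger ρ g k / 2 := by
  have h : sqHellinger ρ g k = ∫ x, (g x + k x - 2 * (√(g x) * √(k x))) ∂ρ := by
    refine integral_congr_ae (.of_forall fun x => ?_)
    simp only
    linear_combination Real.sq_sqrt (hg0 x) + Real.sq_sqrt (hk0 x)
  rw [integral_sub (f := fun x => g x + k x) (hg.add hk)
      ((integrable_sqrt_mul_sqrt hg hk hg0 hk0).const_mul 2),
    integral_add hg hk, hg1, hk1, integral_const_mul] at h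
  linarith

lemma integral_mixabilityGap_le {Z : Type*} [MeasurableSpace Z] {ρ : Measure Z} {Θ : Type*}
    [Countable Θ] {f : Θ → Z → ℝ} (hf_int : ∀ θ, Integrable (f θ) ρ)
    (hf_pos : ∀ θ x, 0 < f θ x) (hf_one : ∀ θ, ∫ x, f θ x ∂ρ = 1) {v : ℝ} (hv : 1 < v)
    (hratio : ∀ (x : Z) (θ θ' : Θ), f θ x ≤ v * f θ' x) {p : Θ → ℝ} (hp : ∀ θ, 0 ≤ p θ)
    (hp1 : HasSum p 1) (θstar : Θ) :
    ∫ x, ((∑' θ, p θ * (-Real.log (f θ x))) + Real.log (∑' θ, p θ * f θ x)) * f θstar x ∂ρ ≤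
      (1 + 2 * v) * ∑' θ, p θ * sqHellinger ρ (f θ) (f θstar) := by
  set F : Z → ℝ := fun x =>
    ((∑' θ, p θ * (-Real.log (f θ x))) + Real.log (∑' θ, p θ * f θ x)) * f θstar x
  set G : Θ → Z → ℝ := fun θ x => p θ * ((1 + 2 * v) * (√(f θ x) - √(f θstar x)) ^ 2)
  have hFG (x : Z) : F x ≤ ∑' θ, G θ x :=
    mixabilityGap_mul_le hv hp hp1 (fun θ => hf_pos θ x) (hf_pos θstar x)
      (fun θ => hratio x θ θstar) (fun θ => hratio x θstar θ)
  have hGint (θ : Θ) : Integrable (G θ) ρ :=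
    ((integrable_sq_sqrt_sub (hf_int θ) (hf_int θstar) (fun x => (hf_pos θ x).le)
      fun x => (hf_pos θstar x).le).const_mul _).const_mul _
  have hG0 (θ : Θ) (x : Z) : 0 ≤ G θ x := by have := hp θ; positivity
  have hGval (θ : Θ) : ∫ x, G θ x ∂ρ = (1 + 2 * v) * (p θ * sqHellinger ρ (f θ) (f θstar)) := by
    simp only [G, integral_const_mul, sqHellinger]; ring
  have hsum : Summable fun θ => p θ * sqHellinger ρ (f θ) (f θstar) := by
    refine Summable.of_nonneg_of_le (fun θ => mul_nonneg (hp θ) (sqHellinger_nonneg _ _ _))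
      (fun θ => mul_le_mul_of_nonneg_left ?_ (hp θ)) (hp1.summable.mul_right 2)
    exact sqHellinger_le_two (hf_int θ) (hf_int θstar) (fun x => (hf_pos θ x).le)
      (fun x => (hf_pos θstar x).le) (hf_one θ) (hf_one θstar)
  have hGsum : Summable fun θ => ∫ x, ‖G θ x‖ ∂ρ := by
    simp only [Real.norm_of_nonneg (hG0 _ _), hGval]
    exact hsum.mul_left _
  have hval : ∑' θ, ∫ x, G θ x ∂ρ = (1 + 2 * v) * ∑' θ, p θ * sqHellinger ρ (f θ) (f θstar) := by
    simp only [hGval, tsum_mul_left]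
  rw [← hval, (hasSum_integral_of_summable_integral_norm hGint hGsum).tsum_eq]
  by_cases hF : Integrable F ρ
  · refine integral_mono hF ?_ hFG
    have hbound (θ : Θ) (x : Z) : G θ x ≤ p θ * ((1 + 2 * v) * ((v + 1) * f θstar x)) := by
      refine mul_le_mul_of_nonneg_left (mul_le_mul_of_nonneg_left ?_ (by linarith)) (hp θ)
      exact (sq_sub_sqrt_le_add (hf_pos θ x).le (hf_pos θstar x).le).trans
        (by linarith [hratio x θ θstar])
    refine Integrable.mono' (((hf_int θstar).const_mul (v + 1)).const_mul (1 + 2 * v))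
      (AEMeasurable.tsum fun θ => (hGint θ).1.aemeasurable).aestronglyMeasurable
      (.of_forall fun x => ?_)
    rw [Real.norm_of_nonneg (tsum_nonneg fun θ => hG0 θ x)]
    have hs := hp1.mul_right ((1 + 2 * v) * ((v + 1) * f θstar x))
    calc _ ≤ _ := (Summable.of_nonneg_of_le (fun θ => hG0 θ x) (fun θ => hbound θ x)
          hs.summable).tsum_le_tsum (fun θ => hbound θ x) hs.summable
      _ = _ := by rw [hs.tsum_eq, one_mul]
  · rw [integral_undef hF]
    exact integral_nonneg fun x => tsum_nonneg fun θ => hG0 θ x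

lemma tsum_mul_le_add_tsum_indicator {Θ : Type*} {p h : Θ → ℝ} (hp : ∀ θ, 0 ≤ p θ)
    (hp1 : HasSum p 1) {s b : ℝ} (hs : 0 ≤ s) (hh0 : ∀ θ, 0 ≤ h θ) (hb : ∀ θ, h θ ≤ b) :
    ∑' θ, p θ * h θ ≤ s + b * ∑' θ, {θ | s ≤ h θ}.indicator p θ := by
  have hsum : Summable fun θ => p θ * h θ :=
    Summable.of_nonneg_of_le (fun θ => mul_nonneg (hp θ) (hh0 θ))
      (fun θ => mul_le_mul_of_nonneg_left (hb θ) (hp θ)) (hp1.summable.mul_right b)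
  have h2 := (hp1.mul_right s).add ((hp1.summable.indicator {θ | s ≤ h θ}).hasSum.mul_left b)
  rw [one_mul] at h2
  rw [← h2.tsum_eq]
  refine hsum.tsum_le_tsum (fun θ => ?_) h2.summable
  by_cases hθ : s ≤ h θ
  · rw [Set.indicator_of_mem (by exact hθ)]
    nlinarith [mul_le_mul_of_nonneg_left (hb θ) (hp θ), mul_nonneg (hp θ) hs]
  · rw [Set.indicator_of_notMem (by exact hθ)]
    nlinarith [mul_le_mul_of_nonneg_left (not_le.1 hθ).le (hp θ)]

section Posterior

variable {Z : Type*} {Θ : Type*} {π : Θ → ℝ} {f : Θ → Z → ℝ} {n : ℕ}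

lemma postNum_pos (hπ_pos : ∀ θ, 0 < π θ) (hf_pos : ∀ θ x, 0 < f θ x) (z : Fin n → Z) (θ : Θ) :
    0 < postNum π f z θ :=
  mul_pos (hπ_pos θ) (Finset.prod_pos fun _ _ => hf_pos _ _)

lemma summable_postNum (hπ_pos : ∀ θ, 0 < π θ) (hπ : HasSum π 1) (hf_pos : ∀ θ x, 0 < f θ x)
    {v : ℝ} (hratio : ∀ (x : Z) (θ θ' : Θ), f θ x ≤ v * f θ' x) (z : Fin n → Z) (θ₀ : Θ) :
    Summable (postNum π f z) :=
  Summable.of_nonneg_of_le (fun θ => (postNum_pos hπ_pos hf_pos z θ).le)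
    (fun θ => mul_le_mul_of_nonneg_left
      (Finset.prod_le_prod (fun _ _ => (hf_pos _ _).le) fun i _ => hratio (z i) θ θ₀)
      (hπ_pos θ).le)
    (hπ.summable.mul_right _)

lemma post_nonneg (hπ_pos : ∀ θ, 0 < π θ) (hf_pos : ∀ θ x, 0 < f θ x) (z : Fin n → Z) (θ : Θ) :
    0 ≤ post π f z θ :=
  div_nonneg (postNum_pos hπ_pos hf_pos z θ).le
    (tsum_nonneg fun θ => (postNum_pos hπ_pos hf_pos z θ).le)

lemma hasSum_post (hπ_pos : ∀ θ, 0 < π θ) (hf_pos : ∀ θ x, 0 < f θ x) {z : Fin n → Z}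
    (hs : Summable (postNum π f z)) (θ₀ : Θ) : HasSum (post π f z) 1 := by
  have hm := hs.tsum_pos (fun θ => (postNum_pos hπ_pos hf_pos z θ).le) θ₀
    (postNum_pos hπ_pos hf_pos z θ₀)
  have := hs.hasSum.div_const (∑' θ, postNum π f z θ)
  rwa [div_self hm.ne'] at this

lemma postNum_mul_post_le (hπ_pos : ∀ θ, 0 < π θ) (hf_pos : ∀ θ x, 0 < f θ x) {z : Fin n → Z}
    (hs : Summable (postNum π f z)) (θ θ' : Θ) :
    postNum π f z θ * post π f z θ' ≤
      √(π θ) * √(π θ') * ∏ i, √(f θ (z i)) * √(f θ' (z i)) := by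
  have hpos := postNum_pos hπ_pos hf_pos z
  have hle (θ) : postNum π f z θ ≤ ∑' θ', postNum π f z θ' :=
    hs.le_tsum θ fun _ _ => (hpos _).le
  have hm : 0 < ∑' θ', postNum π f z θ' := (hpos θ).trans_le (hle θ)
  have hsq : √(π θ) * √(π θ') * ∏ i, √(f θ (z i)) * √(f θ' (z i)) =
      √(postNum π f z θ) * √(postNum π f z θ') := by
    have hprod (θ) : √(∏ i, f θ (z i)) = ∏ i, √(f θ (z i)) :=
      Real.sqrt_prod _ fun i _ => (hf_pos θ (z i)).le
    rw [postNum, postNum, Real.sqrt_mul (hπ_pos _).le, Real.sqrt_mul (hπ_pos _).le,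
      hprod, hprod, Finset.prod_mul_distrib]
    ring
  rw [hsq, post, mul_div_assoc', div_le_iff₀ hm]
  have h1 := Real.sqrt_le_sqrt (hle θ)
  have h2 := Real.sqrt_le_sqrt (hle θ')
  calc postNum π f z θ * postNum π f z θ'
      = √(postNum π f z θ) * √(postNum π f z θ') *
          (√(postNum π f z θ) * √(postNum π f z θ')) := by
        nth_rewrite 1 [← Real.sq_sqrt (hpos θ).le, ← Real.sq_sqrt (hpos θ').le]
        ring
    _ ≤ √(postNum π f z θ) * √(postNum π f z θ') *
          (√(∑' θ', postNum π f z θ') * √(∑' θ', postNum π f z θ')) := by gcongr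
    _ = _ := by rw [Real.mul_self_sqrt hm.le]

end Posterior

lemma lintegral_pi_prod {Z : Type*} [MeasurableSpace Z] {ρ : Measure Z} [SigmaFinite ρ]
    {g : Z → ℝ} (hg : Integrable g ρ) (hg0 : ∀ x, 0 ≤ g x) (n : ℕ) :
    ∫⁻ z, ENNReal.ofReal (∏ i, g (z i)) ∂(Measure.pi fun _ : Fin n => ρ) =
      ENNReal.ofReal ((∫ x, g x ∂ρ) ^ n) := by
  rw [← ofReal_integral_eq_lintegral_ofReal (Integrable.fintype_prod fun _ => hg)
    (.of_forall fun z => Finset.prod_nonneg fun i _ => hg0 _), integral_fintype_prod_eq_pow,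
    Fintype.card_fin]

/-- The joint weight of a pair of parameters, drawn independently from the posterior given a
sample from the Bayesian marginal distribution. -/
def pairWeight {Z : Type*} [MeasurableSpace Z] (ρ : Measure Z) [SigmaFinite ρ] {Θ : Type*}
    (π : Θ → ℝ) (f : Θ → Z → ℝ) (n : ℕ) (θ θ' : Θ) : ℝ≥0∞ :=
  ∫⁻ z, ENNReal.ofReal (postNum π f z θ * post π f z θ') ∂(Measure.pi fun _ : Fin n => ρ)

section PairWeight

variable {Z : Type*} [MeasurableSpace Z] {ρ : Measure Z} {Θ : Type*}
  {π : Θ → ℝ} {f : Θ → Z → ℝ} {n : ℕ}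

lemma measurable_postNum (hf_meas : ∀ θ, Measurable (f θ)) (θ : Θ) :
    Measurable fun z : Fin n → Z => postNum π f z θ := by
  unfold postNum
  exact (Finset.measurable_fun_prod _ fun i _ =>
    (hf_meas θ).comp (measurable_pi_apply i)).const_mul _

lemma measurable_post [Countable Θ] (hf_meas : ∀ θ, Measurable (f θ)) (θ : Θ) :
    Measurable fun z : Fin n → Z => post π f z θ :=
  (measurable_postNum hf_meas θ).div (Measurable.tsum fun θ => measurable_postNum hf_meas θ)

variable [SigmaFinite ρ]

lemma pairWeight_comm (θ θ' : Θ) : pairWeight ρ π f n θ θ' = pairWeight ρ π f n θ' θ := by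
  refine lintegral_congr fun z => ?_
  rw [post, post, mul_div_assoc', mul_div_assoc', mul_comm]

lemma tsum_pairWeight [Countable Θ] (hf_meas : ∀ θ, Measurable (f θ))
    (hf_int : ∀ θ, Integrable (f θ) ρ) (hf_pos : ∀ θ x, 0 < f θ x)
    (hf_one : ∀ θ, ∫ x, f θ x ∂ρ = 1) (hπ_pos : ∀ θ, 0 < π θ)
    (hs : ∀ z : Fin n → Z, Summable (postNum π f z)) (θ : Θ) :
    ∑' θ', pairWeight ρ π f n θ θ' = ENNReal.ofReal (π θ) := by
  have hpt (z : Fin n → Z) :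
      ∑' θ', ENNReal.ofReal (postNum π f z θ * post π f z θ') =
        ENNReal.ofReal (π θ) * ENNReal.ofReal (∏ i, f θ (z i)) := by
    have h := (hasSum_post hπ_pos hf_pos (hs z) θ).mul_left (postNum π f z θ)
    rw [← ENNReal.ofReal_tsum_of_nonneg (fun θ' => mul_nonneg (postNum_pos hπ_pos hf_pos z θ).le
      (post_nonneg hπ_pos hf_pos z θ')) h.summable, h.tsum_eq, mul_one, postNum,
      ENNReal.ofReal_mul (hπ_pos θ).le]
  unfold pairWeight
  have hmeas (θ' : Θ) :
      Measurable fun z : Fin n → Z => ENNReal.ofReal (postNum π f z θ * post π f z θ') :=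
    ((measurable_postNum hf_meas θ).mul (measurable_post hf_meas θ')).ennreal_ofReal
  rw [← lintegral_tsum fun θ' => (hmeas θ').aemeasurable]
  simp only [hpt]
  rw [lintegral_const_mul' _ _ ENNReal.ofReal_ne_top,
    lintegral_pi_prod (hf_int θ) (fun x => (hf_pos θ x).le), hf_one]
  simp

lemma pairWeight_le (hf_int : ∀ θ, Integrable (f θ) ρ) (hf_pos : ∀ θ x, 0 < f θ x)
    (hf_one : ∀ θ, ∫ x, f θ x ∂ρ = 1) (hπ_pos : ∀ θ, 0 < π θ)
    (hs : ∀ z : Fin n → Z, Summable (postNum π f z)) (θ θ' : Θ) :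
    pairWeight ρ π f n θ θ' ≤ ENNReal.ofReal
      (√(π θ) * √(π θ') * Real.exp (-(n * sqHellinger ρ (f θ) (f θ') / 2))) := by
  have hA := integral_sqrt_mul_sqrt (hf_int θ) (hf_int θ') (fun x => (hf_pos θ x).le)
    (fun x => (hf_pos θ' x).le) (hf_one θ) (hf_one θ')
  have hA0 : 0 ≤ ∫ x, √(f θ x) * √(f θ' x) ∂ρ := integral_nonneg fun x => by positivity
  have hAexp : (∫ x, √(f θ x) * √(f θ' x) ∂ρ) ^ n ≤
      Real.exp (-(n * sqHellinger ρ (f θ) (f θ') / 2)) := by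
    calc (∫ x, √(f θ x) * √(f θ' x) ∂ρ) ^ n
        ≤ Real.exp (-(sqHellinger ρ (f θ) (f θ') / 2)) ^ n := by
          refine pow_le_pow_left₀ hA0 ?_ n
          rw [hA]
          exact Real.one_sub_le_exp_neg _
      _ = _ := by rw [← Real.exp_nat_mul]; ring_nf
  calc pairWeight ρ π f n θ θ'
      ≤ ∫⁻ z, ENNReal.ofReal (√(π θ) * √(π θ')) *
          ENNReal.ofReal (∏ i, √(f θ (z i)) * √(f θ' (z i))) ∂(Measure.pi fun _ : Fin n => ρ) := by
        refine lintegral_mono fun z => ?_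
        rw [← ENNReal.ofReal_mul (by positivity)]
        exact ENNReal.ofReal_le_ofReal (postNum_mul_post_le hπ_pos hf_pos (hs z) θ θ')
    _ = ENNReal.ofReal (√(π θ) * √(π θ') * (∫ x, √(f θ x) * √(f θ' x) ∂ρ) ^ n) := by
        rw [lintegral_const_mul' _ _ ENNReal.ofReal_ne_top,
          lintegral_pi_prod (g := fun x => √(f θ x) * √(f θ' x))
            (integrable_sqrt_mul_sqrt (hf_int θ) (hf_int θ') (fun x => (hf_pos θ x).le)
              fun x => (hf_pos θ' x).le) (fun x => by positivity),
          ← ENNReal.ofReal_mul (by positivity)]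
    _ ≤ _ := ENNReal.ofReal_le_ofReal (by gcongr)

end PairWeight

/-- A double sum of a symmetric weight with marginal `π` over the pairs in `B` is small if the
weight is small on the pairs in `B`, up to the contribution of the tail of `π`. -/
lemma tsum_indicator_le_of_tail {Θ : Type*} {π : Θ → ℝ} {J : Θ → Θ → ℝ≥0∞} {B : Θ → Set Θ}
    (hπ_pos : ∀ θ, 0 < π θ) (hπ : HasSum π 1) (hJ : ∀ θ θ', J θ θ' = J θ' θ)
    (hJsum : ∀ θ, ∑' θ', J θ θ' = ENNReal.ofReal (π θ)) {η : ℝ} (hη : η < 1)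
    (hsum : Summable fun θ => π θ ^ η) {N c ε : ℝ} (hN : 0 < N) (hε : 0 ≤ ε)
    (hJB : ∀ θ, ∀ θ' ∈ B θ, J θ θ' ≤ ENNReal.ofReal (√(π θ) * √(π θ') * ε)) :
    ∑' θ, ∑' θ', (B θ).indicator (J θ) θ' ≤
      ENNReal.ofReal (2 * (N ^ (-(c * (1 - η))) * ∑' θ, π θ ^ η) + N ^ c * ε) := by
  classical
  set T : Set Θ := {θ | π θ < N ^ (-c)}
  have hNc : 0 < N ^ c := Real.rpow_pos_of_pos hN c
  have htail (θ : Θ) : T.indicator (fun θ => ENNReal.ofReal (π θ)) θ ≤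
      ENNReal.ofReal (N ^ (-(c * (1 - η))) * π θ ^ η) := by
    by_cases hθ : θ ∈ T
    · rw [Set.indicator_of_mem hθ]
      refine ENNReal.ofReal_le_ofReal ?_
      calc π θ = π θ ^ (1 - η) * π θ ^ η := by
            rw [← Real.rpow_add (hπ_pos θ), sub_add_cancel, Real.rpow_one]
        _ ≤ (N ^ (-c)) ^ (1 - η) * π θ ^ η := by
            have : 0 ≤ π θ := (hπ_pos θ).le
            have : π θ ≤ N ^ (-c) := le_of_lt hθ
            have : 0 ≤ 1 - η := by linarith
            gcongr
        _ = _ := by rw [← Real.rpow_mul hN.le]; ring_nf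
    · rw [Set.indicator_of_notMem hθ]; exact zero_le
  have htailsum : ∑' θ, T.indicator (fun θ => ENNReal.ofReal (π θ)) θ ≤
      ENNReal.ofReal (N ^ (-(c * (1 - η))) * ∑' θ, π θ ^ η) := by
    rw [← tsum_mul_left, ENNReal.ofReal_tsum_of_nonneg
      (fun θ => mul_nonneg (by positivity) (Real.rpow_nonneg (hπ_pos θ).le _)) (hsum.mul_left _)]
    exact ENNReal.tsum_le_tsum htail
  have hpair (θ θ' : Θ) : (B θ).indicator (J θ) θ' ≤
      T.indicator (fun θ => J θ θ') θ + T.indicator (fun θ' => J θ' θ) θ' +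
        ENNReal.ofReal (N ^ c * ε) * (ENNReal.ofReal (π θ) * ENNReal.ofReal (π θ')) := by
    by_cases hB : θ' ∈ B θ
    swap
    · rw [Set.indicator_of_notMem hB]; exact zero_le
    rw [Set.indicator_of_mem hB]
    by_cases h1 : θ ∈ T
    · rw [Set.indicator_of_mem h1, add_assoc]; exact le_self_add
    by_cases h2 : θ' ∈ T
    · rw [Set.indicator_of_mem h2, hJ θ θ', add_right_comm]; exact le_add_self
    refine (hJB θ θ' hB).trans (le_trans ?_ le_add_self)
    rw [← ENNReal.ofReal_mul (hπ_pos θ).le, ← ENNReal.ofReal_mul (by positivity)]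
    refine ENNReal.ofReal_le_ofReal ?_
    have hone {θ} (h : θ ∉ T) : 1 ≤ N ^ c * π θ := by
      have h' : N ^ (-c) ≤ π θ := not_lt.1 h
      rwa [Real.rpow_neg hN.le, inv_le_iff_one_le_mul₀' hNc] at h'
    have hsqrt : √(π θ) * √(π θ') ≤ N ^ c * (π θ * π θ') := by
      have := hπ_pos θ
      have := hπ_pos θ'
      rw [← Real.sqrt_mul (hπ_pos θ).le]
      refine Real.sqrt_le_iff.2 ⟨by positivity, ?_⟩
      calc π θ * π θ' ≤ (π θ * π θ') * ((N ^ c * π θ) * (N ^ c * π θ')) :=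
            le_mul_of_one_le_right (by positivity)
              (one_le_mul_of_one_le_of_one_le (hone h1) (hone h2))
        _ = _ := by ring
    calc _ ≤ N ^ c * (π θ * π θ') * ε := by gcongr
      _ = _ := by ring
  have hπtop : ∑' θ, ENNReal.ofReal (π θ) = 1 := by
    rw [← ENNReal.ofReal_tsum_of_nonneg (fun θ => (hπ_pos θ).le) hπ.summable, hπ.tsum_eq,
      ENNReal.ofReal_one]
  have hind (θ : Θ) : ∑' θ', T.indicator (fun θ => J θ θ') θ =
      T.indicator (fun θ => ENNReal.ofReal (π θ)) θ := by
    by_cases hθ : θ ∈ T <;> simp [hθ, hJsum]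
  have hpow : 0 ≤ N ^ (-(c * (1 - η))) * ∑' θ, π θ ^ η :=
    mul_nonneg (by positivity) (tsum_nonneg fun θ => Real.rpow_nonneg (hπ_pos θ).le _)
  calc ∑' θ, ∑' θ', (B θ).indicator (J θ) θ'
      ≤ ∑' θ, ∑' θ', (T.indicator (fun θ => J θ θ') θ + T.indicator (fun θ' => J θ' θ) θ' +
        ENNReal.ofReal (N ^ c * ε) * (ENNReal.ofReal (π θ) * ENNReal.ofReal (π θ'))) :=
        ENNReal.tsum_le_tsum fun θ => ENNReal.tsum_le_tsum fun θ' => hpair θ θ'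
    _ = ∑' θ, T.indicator (fun θ => ENNReal.ofReal (π θ)) θ +
          ∑' θ, T.indicator (fun θ => ENNReal.ofReal (π θ)) θ + ENNReal.ofReal (N ^ c * ε) := by
        simp only [ENNReal.tsum_add, ENNReal.tsum_mul_left, hπtop, hind, mul_one]
        rw [ENNReal.tsum_comm (f := fun θ θ' => T.indicator (fun θ' => J θ' θ) θ')]
        simp only [hind]
    _ ≤ _ := by
        rw [ENNReal.ofReal_add (by positivity) (by positivity), two_mul,
          ENNReal.ofReal_add hpow hpow]
        gcongr

lemma mul_jointProb_le {Z : Type*} [MeasurableSpace Z] {ρ : Measure Z} [SigmaFinite ρ]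
    {Θ : Type*} [Countable Θ] {π : Θ → ℝ} {f : Θ → Z → ℝ} {n : ℕ}
    (hf_meas : ∀ θ, Measurable (f θ)) (hf_pos : ∀ θ x, 0 < f θ x) (hπ_pos : ∀ θ, 0 < π θ)
    (hs : ∀ z : Fin n → Z, Summable (postNum π f z)) {B : Θ → Set Θ} {t : ℝ}
    {E : Θ → Set (Fin n → Z)}
    (hE : ∀ θ, ∀ z ∈ E θ, t ≤ ∑' θ', (B θ).indicator (post π f z) θ') :
    ENNReal.ofReal t * jointProb ρ π f n E ≤
      ∑' θ, ∑' θ', (B θ).indicator (pairWeight ρ π f n θ) θ' := by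
  unfold jointProb
  rw [← ENNReal.tsum_mul_left]
  refine ENNReal.tsum_le_tsum fun θ => ?_
  set μ := Measure.pi fun _ : Fin n => ρ
  set w : (Fin n → Z) → ℝ≥0∞ := fun z => ENNReal.ofReal (∏ i, f θ (z i))
  set Φ : (Fin n → Z) → ℝ≥0∞ := fun z =>
    ∑' θ', (B θ).indicator (fun θ' => ENNReal.ofReal (post π f z θ')) θ'
  have hmeasInd (θ' : Θ) :
      Measurable fun z : Fin n → Z => (B θ).indicator (fun θ' => ENNReal.ofReal (post π f z θ')) θ' := by
    by_cases h : θ' ∈ B θ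
    · simpa only [Set.indicator_of_mem h] using (measurable_post hf_meas θ').ennreal_ofReal
    · simp only [Set.indicator_of_notMem h, measurable_const]
  have hΦ : Measurable Φ := Measurable.tsum hmeasInd
  have hw : Measurable w := (Finset.measurable_fun_prod _ fun i _ =>
    (hf_meas θ).comp (measurable_pi_apply i)).ennreal_ofReal
  have hsub : E θ ⊆ {z | ENNReal.ofReal t ≤ Φ z} := by
    intro z hz
    have hp := post_nonneg (n := n) hπ_pos hf_pos z
    have h1 := ENNReal.ofReal_le_ofReal (hE θ z hz)
    rw [ENNReal.ofReal_tsum_of_nonneg (fun θ' => Set.indicator_nonneg (fun θ' _ => hp θ') θ')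
      ((hasSum_post hπ_pos hf_pos (hs z) θ).summable.indicator _)] at h1
    refine h1.trans (ENNReal.tsum_le_tsum fun θ' => ?_)
    by_cases h : θ' ∈ B θ <;> simp [h]
  calc ENNReal.ofReal t * (ENNReal.ofReal (π θ) * μ.withDensity w (E θ))
      = ENNReal.ofReal (π θ) * (ENNReal.ofReal t * μ.withDensity w (E θ)) := by ring
    _ ≤ ENNReal.ofReal (π θ) *
          (ENNReal.ofReal t * μ.withDensity w {z | ENNReal.ofReal t ≤ Φ z}) := by gcongr
    _ ≤ ENNReal.ofReal (π θ) * ∫⁻ z, Φ z ∂(μ.withDensity w) := by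
        gcongr
        exact mul_meas_ge_le_lintegral hΦ _
    _ = ∑' θ', ENNReal.ofReal (π θ) *
          ∫⁻ z, w z * (B θ).indicator (fun θ' => ENNReal.ofReal (post π f z θ')) θ' ∂μ := by
        rw [lintegral_tsum fun θ' => (hmeasInd θ').aemeasurable, ← ENNReal.tsum_mul_left]
        refine tsum_congr fun θ' => ?_
        rw [lintegral_withDensity_eq_lintegral_mul _ hw (hmeasInd θ')]
        rfl
    _ = _ := by
        refine tsum_congr fun θ' => ?_
        rw [← lintegral_const_mul' _ _ ENNReal.ofReal_ne_top]
        by_cases h : θ' ∈ B θ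
        · simp only [Set.indicator_of_mem h, pairWeight, w]
          congr! with z
          have h0 : 0 ≤ ∏ i, f θ (z i) := Finset.prod_nonneg fun i _ => (hf_pos _ _).le
          rw [← mul_assoc, ← ENNReal.ofReal_mul (hπ_pos θ).le,
            ← ENNReal.ofReal_mul (mul_nonneg (hπ_pos θ).le h0)]
          rfl
        · simp [h]

/-- Theorem 1, first part: a Bayesian a priori believes the expected mixability gap
is small: with countable `Θ`, uniformly bounded density ratios and a prior with
`Σ π(θ)^η < ∞` for some `η ∈ (0,1)`, for every `a > 0` there are `C₀, C₁ > 0` such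
that for all `n ≥ 2`,
`Π( (θ*, Z^n) : δ̄_n(θ*, Z^n) ≥ C₀ (log n)/n ) ≤ C₁ n^{-a}`. -/
theorem bayesian_belief_in_concentration_expected_gap
    {Z : Type*} [MeasurableSpace Z] (ρ : Measure Z) [SigmaFinite ρ]
    {Θ : Type*} [Countable Θ]
    (f : Θ → Z → ℝ) (hf_meas : ∀ θ, Measurable (f θ))
    (hf_pos : ∀ θ x, 0 < f θ x)
    (hf_int : ∀ θ, ∫ x, f θ x ∂ρ = 1)
    (π : Θ → ℝ) (hπ_pos : ∀ θ, 0 < π θ) (hπ_sum : ∑' θ, π θ = 1)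
    (v : ℝ) (hv : 1 < v)
    (hratio : ∀ (x : Z) (θ θ' : Θ), f θ x ≤ v * f θ' x)
    (η : ℝ) (hη : η ∈ Set.Ioo (0 : ℝ) 1)
    (hsum : Summable fun θ => π θ ^ η) :
    ∀ a : ℝ, 0 < a → ∃ C₀ C₁ : ℝ, 0 < C₀ ∧ 0 < C₁ ∧ ∀ n : ℕ, 2 ≤ n →
      jointProb ρ π f n
          (fun θstar => {z | C₀ * (Real.log n / n) ≤ deltaBar ρ π f θstar z})
        ≤ ENNReal.ofReal (C₁ * (n : ℝ) ^ (-a)) := by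
  intro a ha
  obtain ⟨-, hη1⟩ := hη
  have hint (θ : Θ) : Integrable (f θ) ρ := by
    by_contra h
    exact zero_ne_one ((integral_undef h).symm.trans (hf_int θ))
  have hπ : HasSum π 1 := by
    have : Summable π := by
      by_contra h
      exact zero_ne_one ((tsum_eq_zero_of_not_summable h).symm.trans hπ_sum)
    exact hπ_sum ▸ this.hasSum
  set K := ∑' θ, π θ ^ η
  have hK : 0 ≤ K := tsum_nonneg fun θ => Real.rpow_nonneg (hπ_pos θ).le _
  set c := (a + 1) / (1 - η)
  have hc0 : 0 < c := div_pos (by linarith) (by linarith)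
  have hc : c * (1 - η) = a + 1 := div_mul_cancel₀ _ (by linarith)
  set κ := 2 * (c + a + 1)
  have hκ : 0 < κ := by positivity
  have hlog2 : 0 < Real.log 2 := Real.log_pos one_lt_two
  refine ⟨(1 + 2 * v) * (κ + 1), (2 * K + 1) * (2 / Real.log 2), by positivity, by positivity,
    fun n hn => ?_⟩
  have hN2 : (2 : ℝ) ≤ n := by exact_mod_cast hn
  have hN : (0 : ℝ) < n := by linarith
  have hlogn : Real.log 2 ≤ Real.log n := Real.log_le_log two_pos hN2
  set t := Real.log n / n
  have ht : 0 < t := div_pos (by linarith) hN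
  have hs (z : Fin n → Z) : Summable (postNum π f z) := by
    rcases isEmpty_or_nonempty Θ with h | ⟨⟨θ₀⟩⟩
    · exact summable_empty
    · exact summable_postNum hπ_pos hπ hf_pos hratio z θ₀
  set B : Θ → Set Θ := fun θ => {θ' | κ * t ≤ sqHellinger ρ (f θ') (f θ)}
  have hE : ∀ θ, ∀ z ∈ {z : Fin n → Z | (1 + 2 * v) * (κ + 1) * t ≤ deltaBar ρ π f θ z},
      t / 2 ≤ ∑' θ', (B θ).indicator (post π f z) θ' := by
    intro θ z hz
    have hp := post_nonneg hπ_pos hf_pos z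
    have hp1 := hasSum_post hπ_pos hf_pos (hs z) θ
    have h1 : (1 + 2 * v) * (κ + 1) * t ≤
        (1 + 2 * v) * ∑' θ', post π f z θ' * sqHellinger ρ (f θ') (f θ) :=
      le_trans hz (integral_mixabilityGap_le hint hf_pos hf_int hv hratio hp hp1 θ)
    have h2 : (κ + 1) * t ≤ ∑' θ', post π f z θ' * sqHellinger ρ (f θ') (f θ) := by
      rw [mul_assoc] at h1
      exact le_of_mul_le_mul_left h1 (by linarith)
    have h3 := tsum_mul_le_add_tsum_indicator hp hp1 (mul_pos hκ ht).le
      (fun θ' => sqHellinger_nonneg ρ (f θ') (f θ))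
      (fun θ' => sqHellinger_le_two (hint θ') (hint θ) (fun x => (hf_pos θ' x).le)
        (fun x => (hf_pos θ x).le) (hf_int θ') (hf_int θ))
    change _ ≤ κ * t + 2 * ∑' θ', (B θ).indicator (post π f z) θ' at h3
    linarith
  have hJB : ∀ θ, ∀ θ' ∈ B θ, pairWeight ρ π f n θ θ' ≤
      ENNReal.ofReal (√(π θ) * √(π θ') * (n : ℝ) ^ (-(κ / 2))) := by
    intro θ θ' hθ'
    rw [pairWeight_comm]
    refine (pairWeight_le hint hf_pos hf_int hπ_pos hs θ' θ).trans (ENNReal.ofReal_le_ofReal ?_)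
    rw [mul_comm √(π θ'), Real.rpow_def_of_pos hN]
    gcongr
    have h1 : n * (κ * t) ≤ n * sqHellinger ρ (f θ') (f θ) := by gcongr; exact hθ'
    have h2 : n * (κ * t) = κ * Real.log n := by simp only [t]; field_simp
    linarith
  have hmain := (mul_jointProb_le (ρ := ρ) hf_meas hf_pos hπ_pos hs hE).trans
    (tsum_indicator_le_of_tail (c := c) hπ_pos hπ pairWeight_comm
      (tsum_pairWeight hf_meas hint hf_pos hf_int hπ_pos hs) hη1 hsum hN (by positivity) hJB)
  rw [hc, ← Real.rpow_add hN, show c + -(κ / 2) = -(a + 1) by simp only [κ]; ring,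
    mul_comm, ← ENNReal.le_div_iff_mul_le (.inl (by simpa using ht)) (.inl ENNReal.ofReal_ne_top),
    ← ENNReal.ofReal_div_of_pos (by positivity)] at hmain
  refine hmain.trans (ENNReal.ofReal_le_ofReal ?_)
  have hpow : (n : ℝ) ^ (-(a + 1)) = (n : ℝ) ^ (-a) / n := by
    rw [neg_add, Real.rpow_add hN, Real.rpow_neg_one, div_eq_mul_inv]
  calc _ = (2 * K + 1) * (n : ℝ) ^ (-a) * (2 / Real.log n) := by
        rw [hpow]
        have : Real.log n ≠ 0 := by linarith
        simp only [t]
        field_simp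
        rfl
    _ ≤ (2 * K + 1) * (n : ℝ) ^ (-a) * (2 / Real.log 2) := by gcongr
    _ = _ := by ring
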